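/- arXiv:2112.06738 — 2 statements merged into one kernel-verified Lean document; each statement's English description precedes it below -/
import Mathlib

section
/- A polynomial p ∈ S satisfies: α_H^{m_H n_H} divides e_{H,i}(p) for every H ∈ 𝒜 and every 1 ≤ i ≤ n_H − 1, if and only if α_H^{m_H n_H} divides p − s_H·p for every H ∈ 𝒜. Here e_{H,i}(p) = Σ_{w ∈ W_H} (det w)^i (w·p). -/
open MvPolynomial

noncomputable section

/-- Action of a matrix `M` on polynomials by linear substitution of the variables:
`(polyActM M p)(x) = p (M x)`. -/
def polyActM {N : ℕ} (M : Matrix (Fin N) (Fin N) ℂ) (p : MvPolynomial (Fin N) ℂ) :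
    MvPolynomial (Fin N) ℂ :=
  MvPolynomial.aeval (fun i => ∑ j, MvPolynomial.C (M i j) * MvPolynomial.X j) p

/-- Action of `g ∈ GL_N(ℂ)` on polynomials: `(g · p)(x) = p (g⁻¹ x)`. -/
def polyAct {N : ℕ} (g : Matrix.GeneralLinearGroup (Fin N) ℂ) (p : MvPolynomial (Fin N) ℂ) :
    MvPolynomial (Fin N) ℂ :=
  polyActM (↑(g⁻¹) : Matrix (Fin N) (Fin N) ℂ) p

/-- The linear polynomial with coefficient vector `a`. -/
def linPoly {N : ℕ} (a : Fin N → ℂ) : MvPolynomial (Fin N) ℂ :=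
  ∑ i, MvPolynomial.C (a i) * MvPolynomial.X i

theorem IsPrimitiveRoot.sum_range_pow_mul {d : ℂ} {n : ℕ} (hd : IsPrimitiveRoot d n) (k : ℕ) :
    ∑ i ∈ Finset.range n, d ^ (i * k) = if n ∣ k then (n : ℂ) else 0 := by
  split_ifs with h
  · have h1 : ∀ i ∈ Finset.range n, d ^ (i * k) = 1 := fun i _ =>
      (hd.pow_eq_one_iff_dvd _).2 (h.mul_left i)
    simp [Finset.sum_congr rfl h1]
  · have hk : d ^ k ≠ 1 := fun h' => h ((hd.pow_eq_one_iff_dvd k).1 h')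
    have h1 : ∀ i ∈ Finset.range n, d ^ (i * k) = (d ^ k) ^ i := fun i _ => by
      rw [← pow_mul, mul_comm]
    rw [Finset.sum_congr rfl h1, geom_sum_eq hk, ← pow_mul, mul_comm k n, pow_mul, hd.pow_eq_one]
    simp

/-- Inversion of the discrete Fourier transform, applied to the difference of the first
two values. -/
theorem IsPrimitiveRoot.sum_smul_sum_eq {E : Type*} [AddCommGroup E] [Module ℂ E] {d : ℂ} {n : ℕ}
    (hd : IsPrimitiveRoot d n) (hn : 2 ≤ n) (f : ℕ → E) :
    ∑ i ∈ Finset.range n, (1 - d ^ (i * (n - 1))) •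
      ∑ k ∈ Finset.range n, d ^ (i * k) • f k = (n : ℂ) • (f 0 - f 1) := by
  have h1 : ∀ k ∈ Finset.range n,
      (∑ i ∈ Finset.range n, (1 - d ^ (i * (n - 1))) * d ^ (i * k)) • f k =
        (if k = 0 then (n : ℂ) • f 0 else 0) - (if k = 1 then (n : ℂ) • f 1 else 0) := by
    intro k hk
    rw [Finset.mem_range] at hk
    have h2 : ∑ i ∈ Finset.range n, (1 - d ^ (i * (n - 1))) * d ^ (i * k) =
        ∑ i ∈ Finset.range n, d ^ (i * k) - ∑ i ∈ Finset.range n, d ^ (i * (n - 1 + k)) := by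
      rw [← Finset.sum_sub_distrib]
      refine Finset.sum_congr rfl fun i _ => ?_
      rw [mul_add, pow_add]
      ring
    have h3 : n ∣ k ↔ k = 0 :=
      ⟨fun h => Nat.eq_zero_of_dvd_of_lt h hk, fun h => h ▸ dvd_zero n⟩
    have h4 : n ∣ n - 1 + k ↔ k = 1 := by
      constructor
      · rintro ⟨c, hc⟩
        have hc1 : c = 1 := by
          have h5 : n * c < n * 2 := by omega
          have h6 : 0 < n * c := by omega
          have := Nat.lt_of_mul_lt_mul_left h5
          have := Nat.pos_of_mul_pos_left h6
          omega
        subst hc1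
        omega
      · rintro rfl
        exact ⟨1, by omega⟩
    rw [h2, hd.sum_range_pow_mul, hd.sum_range_pow_mul, sub_smul]
    simp only [h3, h4]
    congr 1 <;> split_ifs with h <;> simp [h]
  simp only [Finset.smul_sum, smul_smul]
  rw [Finset.sum_comm]
  simp only [← Finset.sum_smul]
  rw [Finset.sum_congr rfl h1, Finset.sum_sub_distrib, smul_sub]
  simp only [Finset.sum_ite_eq', Finset.mem_range]
  rw [if_pos (by omega), if_pos (by omega)]

theorem polyActM_mul {N : ℕ} (M K : Matrix (Fin N) (Fin N) ℂ) (p : MvPolynomial (Fin N) ℂ) :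
    polyActM (M * K) p = polyActM K (polyActM M p) := by
  have h : aeval (fun i => ∑ j, C ((M * K) i j) * X j) =
      (aeval fun i => ∑ j, C (K i j) * X j : MvPolynomial (Fin N) ℂ →ₐ[ℂ] _).comp
        (aeval fun i => ∑ j, C (M i j) * X j) := by
    refine algHom_ext fun i => ?_
    simp only [aeval_X, AlgHom.comp_apply, map_sum, map_mul, algHom_C, algebraMap_eq,
      Matrix.mul_apply, Finset.sum_mul, Finset.mul_sum]
    rw [Finset.sum_comm]
    simp only [mul_assoc]
  exact DFunLike.congr_fun h p

theorem polyAct_one {N : ℕ} (p : MvPolynomial (Fin N) ℂ) : polyAct 1 p = p := by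
  simp [polyAct, polyActM, Matrix.one_apply]

theorem polyAct_mul {N : ℕ} (g h : Matrix.GeneralLinearGroup (Fin N) ℂ)
    (p : MvPolynomial (Fin N) ℂ) : polyAct (g * h) p = polyAct g (polyAct h p) := by
  rw [polyAct, mul_inv_rev, Units.val_mul, polyActM_mul]
  rfl

theorem polyActM_linPoly {N : ℕ} (M : Matrix (Fin N) (Fin N) ℂ) (a : Fin N → ℂ) :
    polyActM M (linPoly a) = linPoly (Matrix.vecMul a M) := by
  simp only [polyActM, linPoly, map_sum, map_mul, algHom_C, algebraMap_eq, aeval_X,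
    Matrix.vecMul, dotProduct, Finset.mul_sum, Finset.sum_mul]
  rw [Finset.sum_comm]
  simp only [mul_assoc]

theorem exists_eq_smul_of_forall_dotProduct_eq_zero {ι K : Type*} [Fintype ι] [DecidableEq ι]
    [Field K] {a b : ι → K} (ha : a ≠ 0) (h : ∀ v, a ⬝ᵥ v = 0 → b ⬝ᵥ v = 0) :
    ∃ c : K, b = c • a := by
  obtain ⟨i, hi⟩ := Function.ne_iff.1 ha
  refine ⟨b i / a i, funext fun j => ?_⟩
  have hi' : a i ≠ 0 := hi
  have h1 := h (Pi.single j (a i) - Pi.single i (a j)) (by simp [dotProduct_sub, mul_comm])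
  simp only [dotProduct_sub, dotProduct_single] at h1
  simp only [Pi.smul_apply, smul_eq_mul]
  field_simp
  linear_combination h1

theorem linPoly_dvd_polyAct {N : ℕ} {g : Matrix.GeneralLinearGroup (Fin N) ℂ} {a : Fin N → ℂ}
    (ha : a ≠ 0) (hfix : ∀ v, a ⬝ᵥ v = 0 → (g : Matrix (Fin N) (Fin N) ℂ).mulVec v = v) :
    linPoly a ∣ polyAct g (linPoly a) := by
  obtain ⟨c, hc⟩ := exists_eq_smul_of_forall_dotProduct_eq_zero
    (b := Matrix.vecMul a (↑(g⁻¹) : Matrix (Fin N) (Fin N) ℂ)) ha fun v hv => by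
      have h1 : (↑(g⁻¹) : Matrix (Fin N) (Fin N) ℂ).mulVec v = v := by
        conv_lhs => rw [← hfix v hv]
        rw [Matrix.mulVec_mulVec, ← Units.val_mul, inv_mul_cancel, Units.val_one,
          Matrix.one_mulVec]
      rw [← Matrix.dotProduct_mulVec, h1, hv]
  refine ⟨C c, ?_⟩
  rw [polyAct, polyActM_linPoly, hc]
  simp only [linPoly, Finset.sum_mul, Pi.smul_apply, smul_eq_mul, C_mul]
  exact Finset.sum_congr rfl fun i _ => by ring

theorem polyAct_dvd_polyAct {N : ℕ} (g : Matrix.GeneralLinearGroup (Fin N) ℂ)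
    {p q : MvPolynomial (Fin N) ℂ} (h : p ∣ q) : polyAct g p ∣ polyAct g q :=
  map_dvd (aeval _ : MvPolynomial (Fin N) ℂ →ₐ[ℂ] MvPolynomial (Fin N) ℂ) h

theorem polyAct_sub {N : ℕ} (g : Matrix.GeneralLinearGroup (Fin N) ℂ)
    (p q : MvPolynomial (Fin N) ℂ) : polyAct g (p - q) = polyAct g p - polyAct g q :=
  map_sub (aeval _ : MvPolynomial (Fin N) ℂ →ₐ[ℂ] MvPolynomial (Fin N) ℂ) p q

theorem polyAct_pow {N : ℕ} (g : Matrix.GeneralLinearGroup (Fin N) ℂ)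
    (p : MvPolynomial (Fin N) ℂ) (k : ℕ) : polyAct g (p ^ k) = polyAct g p ^ k :=
  map_pow (aeval _ : MvPolynomial (Fin N) ℂ →ₐ[ℂ] MvPolynomial (Fin N) ℂ) p k

theorem dvd_sub_polyAct_pow {N : ℕ} {g : Matrix.GeneralLinearGroup (Fin N) ℂ}
    {p q : MvPolynomial (Fin N) ℂ} (hq : q ∣ polyAct g q) (h : q ∣ p - polyAct g p) (k : ℕ) :
    q ∣ p - polyAct (g ^ k) p := by
  induction k with
  | zero => simp [polyAct_one]
  | succ k ih =>
    have h1 := hq.trans (polyAct_dvd_polyAct g ih)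
    rw [polyAct_sub, ← polyAct_mul, ← pow_succ'] at h1
    simpa using dvd_add h h1

theorem dvd_smul_of_dvd_right {N : ℕ} {p q : MvPolynomial (Fin N) ℂ} (c : ℂ) (h : q ∣ p) :
    q ∣ c • p := by
  rw [smul_eq_C_mul]
  exact h.mul_left _

theorem dvd_sum_smul_polyAct_iff {N : ℕ} {g : Matrix.GeneralLinearGroup (Fin N) ℂ} {d : ℂ}
    {n : ℕ} (hd : IsPrimitiveRoot d n) (hn : 2 ≤ n) {p q : MvPolynomial (Fin N) ℂ}
    (hq : q ∣ polyAct g q) :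
    (∀ i : ℕ, 1 ≤ i → i ≤ n - 1 →
      q ∣ ∑ k ∈ Finset.range n, d ^ (i * k) • polyAct (g ^ k) p) ↔ q ∣ p - polyAct g p := by
  constructor
  · intro h
    have h1 := hd.sum_smul_sum_eq hn fun k => polyAct (g ^ k) p
    simp only [pow_zero, pow_one, polyAct_one] at h1
    have hn0 : (n : ℂ) ≠ 0 := by exact_mod_cast (by omega : n ≠ 0)
    rw [← inv_smul_smul₀ hn0 (p - polyAct g p), ← h1]
    refine dvd_smul_of_dvd_right _ (Finset.dvd_sum fun i hi => ?_)
    rw [Finset.mem_range] at hi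
    rcases Nat.eq_zero_or_pos i with rfl | hi0
    · simp
    · exact dvd_smul_of_dvd_right _ (h i hi0 (by omega))
  · intro h i hi1 hi2
    have h0 : ∑ k ∈ Finset.range n, d ^ (i * k) = 0 := by
      have h1 := hd.sum_range_pow_mul i
      rw [if_neg (Nat.not_dvd_of_pos_of_lt hi1 (by omega))] at h1
      simpa only [mul_comm] using h1
    have h2 : ∑ k ∈ Finset.range n, d ^ (i * k) • polyAct (g ^ k) p =
        -∑ k ∈ Finset.range n, d ^ (i * k) • (p - polyAct (g ^ k) p) := by
      simp only [smul_sub, Finset.sum_sub_distrib, ← Finset.sum_smul, h0, zero_smul, zero_sub,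
        neg_neg]
    rw [h2, dvd_neg]
    exact Finset.dvd_sum fun k _ => dvd_smul_of_dvd_right _ (dvd_sub_polyAct_pow hq h k)

/-- For a polynomial `p`, the divisibility `α_H^{m_H n_H} ∣ e_{H,i}(p)` for all
`H ∈ 𝒜` and `1 ≤ i ≤ n_H - 1` is equivalent to `α_H^{m_H n_H} ∣ p - s_H·p` for all `H ∈ 𝒜`.
Here `W_H = ⟨s_H⟩` is cyclic of order `n_H`, so
`e_{H,i}(p) = Σ_{k=0}^{n_H-1} (det s_H)^{i·k} (s_H^k · p)`. -/
theorem stmt_0 (N : ℕ) (hN : 0 < N) (A : Type)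
    -- the generator `s_H` of the pointwise stabilizer `W_H` of each hyperplane `H ∈ 𝒜`
    (s : A → Matrix.GeneralLinearGroup (Fin N) ℂ)
    -- its order `n_H ≥ 2`
    (n : A → ℕ) (hn2 : ∀ H, 2 ≤ n H)
    (horder : ∀ H, orderOf (s H) = n H)
    -- `det s_H` is a primitive `n_H`-th root of unity
    (hdet : ∀ H, orderOf ((↑(s H) : Matrix (Fin N) (Fin N) ℂ).det) = n H)
    -- the linear form `α_H` with kernel `H`, fixed pointwise by `s_H`
    (α : A → (Fin N → ℂ)) (hα : ∀ H, α H ≠ 0)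
    (hfix : ∀ H (v : Fin N → ℂ), (∑ i, α H i * v i) = 0 →
      (↑(s H) : Matrix (Fin N) (Fin N) ℂ).mulVec v = v)
    -- the multiplicity function
    (m : A → ℕ)
    (p : MvPolynomial (Fin N) ℂ) :
    (∀ H, ∀ i : ℕ, 1 ≤ i → i ≤ n H - 1 →
        linPoly (α H) ^ (m H * n H) ∣
          ∑ k ∈ Finset.range (n H),
            ((↑(s H) : Matrix (Fin N) (Fin N) ℂ).det ^ (i * k)) • polyAct ((s H) ^ k) p)
      ↔ (∀ H, linPoly (α H) ^ (m H * n H) ∣ p - polyAct (s H) p) := by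
  refine forall_congr' fun H => ?_
  refine dvd_sum_smul_polyAct_iff (hdet H ▸ IsPrimitiveRoot.orderOf _) (hn2 H) ?_
  rw [polyAct_pow]
  exact pow_dvd_pow_of_dvd (linPoly_dvd_polyAct (hα H) (hfix H)) _

end
end

section
/- Let L = Σ_{i=1}^N f_i ∂_{x_i} (f_i ∈ S) be a W-invariant polynomial vector field. Then L ∈ D_m, i.e. α_H^{m_H n_H + 1} divides L(α_H) for every H ∈ 𝒜, if and only if f_i ∈ Q_m for all 1 ≤ i ≤ N. -/
open MvPolynomial

noncomputable section

/-- The polynomial vector field `L = Σ f_i ∂_i` applied to a polynomial. -/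
def applyVF {N : ℕ} (f : Fin N → MvPolynomial (Fin N) ℂ) (p : MvPolynomial (Fin N) ℂ) :
    MvPolynomial (Fin N) ℂ :=
  ∑ i, f i * MvPolynomial.pderiv i p

/-- The set `Q_m` of `m`-quasi-invariants. -/
def QmSet {N : ℕ} {A : Type} (s : A → Matrix.GeneralLinearGroup (Fin N) ℂ)
    (α : A → (Fin N → ℂ)) (n m : A → ℕ) : Set (MvPolynomial (Fin N) ℂ) :=
  {p | ∀ H, linPoly (α H) ^ (m H * n H) ∣ p - polyAct (s H) p}

/-- The action of `g` on polynomials as an algebra homomorphism. -/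
def polyActHom {N : ℕ} (g : Matrix.GeneralLinearGroup (Fin N) ℂ) :
    MvPolynomial (Fin N) ℂ →ₐ[ℂ] MvPolynomial (Fin N) ℂ :=
  MvPolynomial.aeval
    (fun i => ∑ j, MvPolynomial.C ((↑(g⁻¹) : Matrix (Fin N) (Fin N) ℂ) i j) * MvPolynomial.X j)

lemma polyAct_eq_polyActHom {N : ℕ} (g : Matrix.GeneralLinearGroup (Fin N) ℂ)
    (p : MvPolynomial (Fin N) ℂ) : polyAct g p = polyActHom g p := rfl

lemma polyActHom_X {N : ℕ} (g : Matrix.GeneralLinearGroup (Fin N) ℂ) (i : Fin N) :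
    polyActHom g (X i) = linPoly ((↑(g⁻¹) : Matrix (Fin N) (Fin N) ℂ) i) := by
  simp [polyActHom, linPoly]

lemma polyActHom_linPoly {N : ℕ} (g : Matrix.GeneralLinearGroup (Fin N) ℂ) (a : Fin N → ℂ) :
    polyActHom g (linPoly a) =
      linPoly (Matrix.vecMul a (↑(g⁻¹) : Matrix (Fin N) (Fin N) ℂ)) := by
  have hC : ∀ c : ℂ, polyActHom g (C c) = C c := fun c => by
    simp [polyActHom]
  conv_lhs => rw [linPoly]
  simp only [map_sum, map_mul, hC, polyActHom_X]
  simp only [linPoly, Matrix.vecMul, dotProduct, Finset.mul_sum, map_sum, map_mul, Finset.sum_mul]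
  rw [Finset.sum_comm]
  simp only [mul_assoc]

lemma pderiv_linPoly {N : ℕ} (a : Fin N → ℂ) (i : Fin N) :
    pderiv i (linPoly a) = C (a i) := by
  simp [linPoly, Derivation.leibniz, pderiv_X, Pi.single_apply]

lemma applyVF_linPoly {N : ℕ} (f : Fin N → MvPolynomial (Fin N) ℂ) (a : Fin N → ℂ) :
    applyVF f (linPoly a) = ∑ i, C (a i) * f i := by
  simp [applyVF, pderiv_linPoly, mul_comm]

lemma linPoly_smul {N : ℕ} (c : ℂ) (a : Fin N → ℂ) : linPoly (c • a) = C c * linPoly a := by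
  simp [linPoly, Finset.mul_sum, mul_assoc]

lemma linPoly_ne_zero {N : ℕ} {a : Fin N → ℂ} (ha : a ≠ 0) : linPoly a ≠ 0 := by
  intro h
  apply ha
  ext i
  have h' := pderiv_linPoly a i
  rw [h, map_zero] at h'
  exact (C_injective (Fin N) ℂ (by simpa using h'.symm))

/-- A ring element dividing all `X i - φ (X i)` divides every `p - φ p`. -/
lemma dvd_sub_algHom {σ R : Type*} [CommRing R] (φ : MvPolynomial σ R →ₐ[R] MvPolynomial σ R)
    (a : MvPolynomial σ R) (h : ∀ i, a ∣ X i - φ (X i)) (p : MvPolynomial σ R) :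
    a ∣ p - φ p := by
  induction p using MvPolynomial.induction_on with
  | C c => simp [← algebraMap_eq]
  | add p q hp hq =>
    rw [map_add, add_sub_add_comm]
    exact dvd_add hp hq
  | mul_X p i hp =>
    rw [map_mul, show p * X i - φ p * φ (X i) = (p - φ p) * X i + φ p * (X i - φ (X i)) by ring]
    exact dvd_add (hp.mul_right _) ((h i).mul_left _)

lemma eq_one_sub_vecMulVec {N : ℕ} {M : Matrix (Fin N) (Fin N) ℂ} {a b : Fin N → ℂ}
    (h : ∀ v : Fin N → ℂ, M.mulVec v = v - (∑ i, a i * v i) • b) :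
    M = 1 - Matrix.vecMulVec b a := by
  ext i j
  have := congrFun (h (Pi.single j 1)) i
  simpa [Pi.single_apply, Matrix.one_apply, Matrix.vecMulVec_apply, mul_comm] using this

lemma vecMul_one_sub_vecMulVec {N : ℕ} (a b : Fin N → ℂ) :
    Matrix.vecMul a (1 - Matrix.vecMulVec b a) = (1 - a ⬝ᵥ b) • a := by
  rw [Matrix.vecMul_sub, Matrix.vecMul_one, Matrix.vecMul_vecMulVec, sub_smul, one_smul]

lemma vecMul_pow_of_eq_smul {N : ℕ} {M : Matrix (Fin N) (Fin N) ℂ} {a : Fin N → ℂ} {c : ℂ}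
    (h : Matrix.vecMul a M = c • a) (k : ℕ) : Matrix.vecMul a (M ^ k) = c ^ k • a := by
  induction k with
  | zero => simp
  | succ k ih => rw [pow_succ, ← Matrix.vecMul_vecMul, ih, Matrix.smul_vecMul, h, smul_smul,
      pow_succ]

/-- The powers of a transvection. -/
lemma one_sub_vecMulVec_pow {N : ℕ} {a b : Fin N → ℂ} (h : a ⬝ᵥ b = 0) (k : ℕ) :
    (1 - Matrix.vecMulVec b a) ^ k = 1 - (k : ℂ) • Matrix.vecMulVec b a := by
  induction k with
  | zero => simp
  | succ k ih =>
    have h0 : Matrix.vecMulVec b a * Matrix.vecMulVec b a = 0 := by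
      rw [Matrix.vecMulVec_mul_vecMulVec, h]; simp
    rw [pow_succ, ih, mul_sub, mul_one, sub_mul, one_mul, Matrix.smul_mul, h0, Nat.cast_succ,
      add_smul, one_smul, smul_zero, sub_zero, sub_sub]

/-- For a vector field invariant under a single reflection `g` with root `a`, divisibility of
`L(a)` by `a ^ (k * n + 1)` is equivalent to quasi-invariance of the components with respect
to `g`. -/
lemma reflection_dvd_iff {N : ℕ} {g : Matrix.GeneralLinearGroup (Fin N) ℂ} {n : ℕ} (hn2 : 2 ≤ n)
    (horder : orderOf g = n) {a b : Fin N → ℂ} (ha : a ≠ 0) (hb : b ≠ 0)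
    (hform : ∀ v : Fin N → ℂ,
      (↑g : Matrix (Fin N) (Fin N) ℂ).mulVec v = v - (∑ i, a i * v i) • b)
    (f : Fin N → MvPolynomial (Fin N) ℂ)
    (hinv : ∀ p : MvPolynomial (Fin N) ℂ, polyAct g (applyVF f (polyAct g⁻¹ p)) = applyVF f p)
    (k : ℕ) :
    linPoly a ^ (k * n + 1) ∣ applyVF f (linPoly a) ↔
      ∀ i, linPoly a ^ (k * n) ∣ f i - polyAct g (f i) := by
  have hM := eq_one_sub_vecMulVec hform
  set M : Matrix (Fin N) (Fin N) ℂ := ↑g with hMdef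
  set T : Matrix (Fin N) (Fin N) ℂ := ↑(g⁻¹) with hTdef
  have hMT : M * T = 1 := by rw [hMdef, hTdef, ← Units.val_mul]; simp
  have hMn : M ^ n = 1 := by
    rw [hMdef, ← Units.val_pow_eq_pow_val, ← horder, pow_orderOf_eq_one]; rfl
  set c : ℂ := 1 - a ⬝ᵥ b with hc
  have haM : Matrix.vecMul a M = c • a := by rw [hM]; exact vecMul_one_sub_vecMulVec a b
  have haT : c • Matrix.vecMul a T = a := by
    rw [← Matrix.smul_vecMul, ← haM, Matrix.vecMul_vecMul, hMT, Matrix.vecMul_one]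
  have hcn : c ^ n = 1 := by
    have h := vecMul_pow_of_eq_smul haM n
    rw [hMn, Matrix.vecMul_one] at h
    obtain ⟨i, hi⟩ := Function.ne_iff.mp ha
    have h' := congrFun h i
    simp only [Pi.smul_apply, smul_eq_mul] at h'
    exact mul_right_cancel₀ hi (by rw [one_mul]; exact h'.symm)
  have hc0 : c ≠ 0 := by
    rintro h
    rw [h, zero_smul] at haT
    exact ha haT.symm
  have hc1 : c ≠ 1 := by
    intro h
    have hab : a ⬝ᵥ b = 0 := by
      rw [hc] at h
      linear_combination -h
    have h1 := one_sub_vecMulVec_pow hab n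
    rw [← hM, hMn] at h1
    have h2 : (n : ℂ) • Matrix.vecMulVec b a = 0 := by
      rw [eq_sub_iff_add_eq] at h1
      exact add_eq_left.mp h1
    obtain ⟨i, hi⟩ := Function.ne_iff.mp hb
    obtain ⟨j, hj⟩ := Function.ne_iff.mp ha
    have h3 := congrFun (congrFun h2 i) j
    simp only [Matrix.smul_apply, Matrix.vecMulVec_apply, smul_eq_mul, Matrix.zero_apply,
      mul_eq_zero, Nat.cast_eq_zero] at h3
    rcases h3 with h3 | h3 | h3
    · omega
    · exact hi h3
    · exact hj h3
  set φ := polyActHom g with hφ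
  have hφC : ∀ z : ℂ, φ (C z) = C z := fun z => by simp [hφ, polyActHom]
  set G := applyVF f (linPoly a) with hG
  set ℓ := linPoly a with hℓ
  have hℓ0 : ℓ ≠ 0 := linPoly_ne_zero ha
  have hφℓ : C c * φ ℓ = ℓ := by
    rw [hφ, hℓ, polyActHom_linPoly, ← linPoly_smul, ← hTdef, haT]
  have hφf : ∀ p : Fin N → ℂ, φ (∑ j, C (Matrix.vecMul p M j) * f j) = ∑ i, C (p i) * f i := by
    intro p
    have h := hinv (linPoly p)
    rw [polyAct_eq_polyActHom, polyAct_eq_polyActHom, polyActHom_linPoly, inv_inv,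
      applyVF_linPoly, applyVF_linPoly] at h
    exact h
  have hφG : C c * φ G = G := by
    have h := hφf a
    rw [haM] at h
    simp only [Pi.smul_apply, smul_eq_mul, map_mul, mul_assoc, ← Finset.mul_sum, hφC] at h
    rwa [hG, hℓ, applyVF_linPoly]
  have hdiff : ∀ i, f i - polyAct g (f i) = -C (b i) * φ G := by
    intro i
    have h := hφf (Pi.single i 1)
    rw [hM, Matrix.vecMul_sub, Matrix.vecMul_one, Matrix.vecMul_vecMulVec] at h
    rw [hG, hℓ, applyVF_linPoly, polyAct_eq_polyActHom, ← hφ]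
    simp only [single_dotProduct, one_mul, Pi.sub_apply, Pi.smul_apply, smul_eq_mul, map_sub,
      map_mul, sub_mul, Finset.sum_sub_distrib, map_sum, hφC, Pi.single_apply] at h
    simp only [apply_ite C, map_one, map_zero, ite_mul, one_mul, zero_mul, Finset.sum_ite_eq',
      Finset.mem_univ, if_true, mul_assoc, ← Finset.mul_sum] at h
    simp only [map_sum, map_mul, hφC]
    linear_combination -h
  have hdvdX : ∀ i, ℓ ∣ X i - φ (X i) := by
    intro i
    have hrow : φ (X i) = X i + C (b i) * φ ℓ := by
      rw [hφ, hℓ, polyActHom_X, polyActHom_linPoly, ← hTdef]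
      have h1 : T - Matrix.vecMulVec b (Matrix.vecMul a T) = 1 := by
        rw [← hMT, hM, sub_mul, one_mul, Matrix.vecMulVec_mul]
      have h2 : T i = Pi.single i 1 + b i • Matrix.vecMul a T := by
        ext j
        have h3 := congrFun (congrFun h1 i) j
        simp only [Matrix.sub_apply, Matrix.vecMulVec_apply, Matrix.one_apply] at h3
        simp only [Pi.add_apply, Pi.single_apply, Pi.smul_apply, smul_eq_mul, eq_comm (a := j)]
        linear_combination h3
      rw [← linPoly_smul]
      conv_lhs => rw [h2]
      simp [linPoly, add_mul, Finset.sum_add_distrib, Pi.single_apply]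
    refine ⟨-C (b i) * C c⁻¹, ?_⟩
    have hcc : (C c⁻¹ : MvPolynomial (Fin N) ℂ) * C c = 1 := by
      rw [← C_mul, inv_mul_cancel₀ hc0, C_1]
    rw [hrow]
    linear_combination -(C (b i) * C c⁻¹) * hφℓ + (C (b i) * φ ℓ) * hcc
  have hCu : ∀ z : ℂ, z ≠ 0 → IsUnit (C z : MvPolynomial (Fin N) ℂ) := fun z hz =>
    (isUnit_iff_ne_zero.mpr hz).map C
  constructor
  · intro h i
    have h' : ℓ ^ (k * n) ∣ C c * φ G := by
      rw [hφG]
      exact (pow_dvd_pow ℓ (Nat.le_succ _)).trans h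
    rw [hdiff]
    exact ((hCu c hc0).dvd_mul_left.mp h').mul_left _
  · intro h
    obtain ⟨i, hi⟩ := Function.ne_iff.mp hb
    have h' := h i
    rw [hdiff, (hCu (b i) hi).neg.dvd_mul_left] at h'
    obtain ⟨q, hq⟩ : ℓ ^ (k * n) ∣ G := hφG ▸ h'.mul_left (C c)
    have hpow : φ ℓ ^ (k * n) = ℓ ^ (k * n) := by
      conv_rhs => rw [← hφℓ, mul_pow, ← C_pow, mul_comm k n, pow_mul, hcn, one_pow, C_1, one_mul]
      rw [mul_comm k n]
    have hq' : C c * φ q = q := by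
      apply mul_left_cancel₀ (pow_ne_zero (k * n) hℓ0)
      have h1 := hφG
      rw [hq, map_mul, map_pow, hpow] at h1
      linear_combination h1
    have hdq : ℓ ∣ C (c - 1) * q := by
      obtain ⟨r, hr⟩ := dvd_sub_algHom φ ℓ hdvdX q
      refine ⟨C c * r, ?_⟩
      rw [C_sub, C_1]
      linear_combination C c * hr + hq'
    rw [(hCu _ (sub_ne_zero.mpr hc1)).dvd_mul_left] at hdq
    rw [hq, pow_succ]
    exact mul_dvd_mul_left _ hdq

/-- a `W`-invariant polynomial vector field `L = Σ f_i ∂_i` satisfies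
`α_H^{m_H n_H + 1} ∣ L(α_H)` for all `H ∈ 𝒜` (i.e. `L ∈ D_m`) if and only if
all its components `f_i` are `m`-quasi-invariants. -/
theorem stmt_2 (N : ℕ) (hN : 0 < N)
    -- the finite reflection group `W`
    (W : Subgroup (Matrix.GeneralLinearGroup (Fin N) ℂ)) (hWfin : Finite W)
    (A : Type)
    -- the generator `s_H` of the pointwise stabilizer of `H ∈ 𝒜`, of order `n_H`
    (s : A → Matrix.GeneralLinearGroup (Fin N) ℂ) (hsW : ∀ H, s H ∈ W)
    (n : A → ℕ) (hn2 : ∀ H, 2 ≤ n H) (horder : ∀ H, orderOf (s H) = n H)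
    -- `α_H` and `α_H^∨` with `s_H v = v - α_H(v) α_H^∨`
    (α : A → (Fin N → ℂ)) (hα : ∀ H, α H ≠ 0)
    (αv : A → (Fin N → ℂ)) (hαv : ∀ H, αv H ≠ 0)
    (hform : ∀ H (v : Fin N → ℂ),
      (↑(s H) : Matrix (Fin N) (Fin N) ℂ).mulVec v = v - (∑ i, α H i * v i) • αv H)
    -- the `W`-invariant multiplicity function
    (m : A → ℕ)
    (hminv : ∀ g ∈ W, ∀ H, ∃ H', (∃ c : ℂ, c ≠ 0 ∧
        α H' = c • Matrix.vecMul (α H) (↑(g⁻¹) : Matrix (Fin N) (Fin N) ℂ)) ∧ m H' = m H)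
    -- a `W`-invariant polynomial vector field `L = Σ f_i ∂_i`
    (f : Fin N → MvPolynomial (Fin N) ℂ)
    (hinv : ∀ g ∈ W, ∀ p : MvPolynomial (Fin N) ℂ,
      polyAct g (applyVF f (polyAct g⁻¹ p)) = applyVF f p) :
    (∀ H, linPoly (α H) ^ (m H * n H + 1) ∣ applyVF f (linPoly (α H)))
      ↔ (∀ i, f i ∈ QmSet s α n m) := by
  have key : ∀ H,
      (linPoly (α H) ^ (m H * n H + 1) ∣ applyVF f (linPoly (α H))) ↔
        ∀ i, linPoly (α H) ^ (m H * n H) ∣ f i - polyAct (s H) (f i) := by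
    intro H
    exact reflection_dvd_iff (hn2 H) (horder H) (hα H) (hαv H) (hform H) f (hinv _ (hsW H)) (m H)
  simp only [key, QmSet, Set.mem_ofPred_eq]
  exact forall_comm


end
end
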